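/- Fix 0 < q < 1 and an integer n ≥ 1. For 0 < α < q^{-1}, the second family Al-Salam–Carlitz polynomial V_n^{(α)}(·;q) has n distinct real zeros x_1(α) < ⋯ < x_n(α), and for each j ∈ {1,...,n} the zero x_j(α) is a strictly increasing function of α on (0, q^{-1}). -/

import Mathlib

/-- q-Pochhammer symbol `(a;q)_k = ∏_{j=0}^{k-1} (1 - a q^j)`. -/
noncomputable def qpoch (q a : ℝ) (k : ℕ) : ℝ := ∏ j ∈ Finset.range k, (1 - a * q ^ j)

/-- Second family Al-Salam–Carlitz polynomial `V_n^{(α)}(x;q)`. -/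
noncomputable def alSalamCarlitzV (q : ℝ) (n : ℕ) (α x : ℝ) : ℝ :=
  (-α) ^ n * (q ^ (n * (n - 1) / 2))⁻¹ *
    ∑ k ∈ Finset.range (n + 1),
      qpoch q (q ^ (-(n : ℤ))) k * qpoch q x k / qpoch q q k *
        ((-1) ^ k * (q ^ (k * (k - 1) / 2))⁻¹ * (q ^ n / α) ^ k)

section

open Polynomial

lemma qpoch_zero (q a : ℝ) : qpoch q a 0 = 1 := by simp [qpoch]

lemma qpoch_succ (q a : ℝ) (k : ℕ) : qpoch q a (k + 1) = qpoch q a k * (1 - a * q ^ k) :=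
  Finset.prod_range_succ _ _

lemma qpoch_succ' (q a : ℝ) (k : ℕ) : qpoch q a (k + 1) = (1 - a) * qpoch q (q * a) k := by
  simp only [qpoch, Finset.prod_range_succ', pow_zero, mul_one]
  rw [mul_comm]
  congr 1
  exact Finset.prod_congr rfl fun j _ => by ring

/-- The coefficient of `(x;q)_k α^{-k}` in the basic hypergeometric sum defining `V_n`;
it is the Gaussian binomial coefficient. -/
noncomputable def qbinom (q : ℝ) (n k : ℕ) : ℝ :=
  qpoch q (q ^ (-(n : ℤ))) k / qpoch q q k * ((-1) ^ k * (q ^ (k * (k - 1) / 2))⁻¹ * (q ^ n) ^ k)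

lemma one_sub_pow_succ_pos {q : ℝ} (hq0 : 0 < q) (hq1 : q < 1) (k : ℕ) : 0 < 1 - q ^ (k + 1) :=
  sub_pos.2 (pow_lt_one₀ hq0.le hq1 k.succ_ne_zero)

lemma qpoch_self_ne_zero {q : ℝ} (hq0 : 0 < q) (hq1 : q < 1) (k : ℕ) : qpoch q q k ≠ 0 := by
  refine Finset.prod_ne_zero_iff.2 fun j _ => ?_
  rw [← pow_succ']
  exact (one_sub_pow_succ_pos hq0 hq1 j).ne'

@[simp] lemma qbinom_zero (q : ℝ) (n : ℕ) : qbinom q n 0 = 1 := by simp [qbinom, qpoch]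

lemma qbinom_succ_mul {q : ℝ} (hq0 : 0 < q) (hq1 : q < 1) (n k : ℕ) :
    qbinom q n (k + 1) * (1 - q ^ (k + 1)) = qbinom q n k * (1 - q ^ n / q ^ k) := by
  have h1 := qpoch_self_ne_zero hq0 hq1 k
  have h2 := (one_sub_pow_succ_pos hq0 hq1 k).ne'
  have h3 : (k + 1) * (k + 1 - 1) / 2 = k * (k - 1) / 2 + k := by
    rw [← Finset.sum_range_id_mul_two (k + 1) |> fun h => Nat.eq_div_of_mul_eq_left two_ne_zero h,
      ← Finset.sum_range_id_mul_two k |> fun h => Nat.eq_div_of_mul_eq_left two_ne_zero h,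
      Finset.sum_range_succ]
  rw [pow_succ'] at h2
  rw [pow_succ' q k]
  simp only [qbinom, qpoch_succ, h3, zpow_neg, zpow_natCast]
  generalize 1 - q * q ^ k = D at h2 ⊢
  field_simp
  ring

lemma qbinom_succ_succ_mul {q : ℝ} (hq0 : 0 < q) (hq1 : q < 1) (n k : ℕ) :
    qbinom q (n + 1) (k + 1) * (1 - q ^ (k + 1)) = (1 - q ^ (n + 1)) * qbinom q n k := by
  induction k with
  | zero => rw [qbinom_succ_mul hq0 hq1]; simp
  | succ k ih =>
    have h1 := qbinom_succ_mul hq0 hq1 (n + 1) (k + 1)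
    have h2 := qbinom_succ_mul hq0 hq1 n k
    have h3 := (one_sub_pow_succ_pos hq0 hq1 k).ne'
    have h5 : q ^ (n + 1) / q ^ (k + 1) = q ^ n / q ^ k := by
      rw [pow_succ, pow_succ, mul_div_mul_right _ _ hq0.ne']
    rw [h5] at h1
    rw [h1]
    apply mul_right_cancel₀ h3
    linear_combination (1 - q ^ n / q ^ k) * ih - (1 - q ^ (n + 1)) * h2

lemma qbinom_succ_succ {q : ℝ} (hq0 : 0 < q) (hq1 : q < 1) (n k : ℕ) :
    qbinom q (n + 1) (k + 1) = qbinom q n k + q ^ (k + 1) * qbinom q n (k + 1) := by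
  apply mul_right_cancel₀ (one_sub_pow_succ_pos hq0 hq1 k).ne'
  have h : q ^ (k + 1) * (q ^ n / q ^ k) = q ^ (n + 1) := by field_simp; ring
  linear_combination qbinom_succ_succ_mul hq0 hq1 n k - q ^ (k + 1) * qbinom_succ_mul hq0 hq1 n k
    + qbinom q n k * h

lemma qbinom_self_succ {q : ℝ} (hq0 : 0 < q) (hq1 : q < 1) (n : ℕ) :
    qbinom q n (n + 1) = 0 := by
  apply mul_right_cancel₀ (one_sub_pow_succ_pos hq0 hq1 n).ne'
  rw [qbinom_succ_mul hq0 hq1, div_self (pow_pos hq0 n).ne']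
  ring

/-- The second family Al-Salam–Carlitz polynomial, up to a nonzero constant factor. -/
noncomputable def ascPoly (q α : ℝ) (n : ℕ) : ℝ[X] :=
  ∑ k ∈ Finset.range (n + 1),
    C (qbinom q n k * α⁻¹ ^ k) * ∏ j ∈ Finset.range k, (1 - C (q ^ j) * X)

lemma eval_ascPoly (q α x : ℝ) (n : ℕ) :
    (ascPoly q α n).eval x =
      ∑ k ∈ Finset.range (n + 1), qbinom q n k * α⁻¹ ^ k * qpoch q x k := by
  simp [ascPoly, eval_finsetSum, eval_prod, qpoch, mul_comm]

lemma alSalamCarlitzV_eq (q α x : ℝ) (n : ℕ) :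
    alSalamCarlitzV q n α x =
      (-α) ^ n * (q ^ (n * (n - 1) / 2))⁻¹ * (ascPoly q α n).eval x := by
  rw [eval_ascPoly, alSalamCarlitzV]
  congr 1
  refine Finset.sum_congr rfl fun k _ => ?_
  rw [qbinom, div_eq_mul_inv (q ^ n) α, mul_pow]
  ring

lemma alSalamCarlitzV_eq_zero_iff {q α : ℝ} (hq : q ≠ 0) (hα : α ≠ 0) (n : ℕ) (x : ℝ) :
    alSalamCarlitzV q n α x = 0 ↔ (ascPoly q α n).IsRoot x := by
  simp [alSalamCarlitzV_eq, hq, hα]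

lemma natDegree_ascPoly_le (q α : ℝ) (n : ℕ) : (ascPoly q α n).natDegree ≤ n := by
  refine natDegree_sum_le_of_forall_le _ _ fun k hk => (natDegree_C_mul_le _ _).trans ?_
  refine (natDegree_prod_le _ _).trans ((Finset.sum_le_card_nsmul _ _ 1 fun j _ => ?_).trans ?_)
  · compute_degree
  · simpa using Nat.lt_succ_iff.1 (Finset.mem_range.1 hk)

lemma ascPoly_ne_zero (q α : ℝ) (n : ℕ) : ascPoly q α n ≠ 0 := by
  intro h
  have h1 := eval_ascPoly q α 1 n
  rw [Finset.sum_range_succ'] at h1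
  simp [h, qpoch_succ', qpoch_zero] at h1

lemma ascPoly_raising {q α : ℝ} (hq0 : 0 < q) (hq1 : q < 1) (hα : α ≠ 0) (n : ℕ) (x : ℝ) :
    α * x * (ascPoly q α (n + 1)).eval x =
      α * (ascPoly q α n).eval x - (x - 1) * (x - α) * (ascPoly q α n).eval (q * x) := by
  have h1 : (1 - x) * (ascPoly q α n).eval (q * x) =
      ∑ k ∈ Finset.range (n + 1), qbinom q n k * α⁻¹ ^ k * qpoch q x (k + 1) := by
    rw [eval_ascPoly, Finset.mul_sum]
    exact Finset.sum_congr rfl fun k _ => by rw [qpoch_succ']; ring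
  have h2 : (ascPoly q α (n + 1)).eval x =
      α⁻¹ * ((1 - x) * (ascPoly q α n).eval (q * x)) +
        ∑ k ∈ Finset.range (n + 1), q ^ k * qbinom q n k * α⁻¹ ^ k * qpoch q x k := by
    have h3 : ∑ k ∈ Finset.range (n + 1), q ^ k * qbinom q n k * α⁻¹ ^ k * qpoch q x k =
        ∑ k ∈ Finset.range (n + 2), q ^ k * qbinom q n k * α⁻¹ ^ k * qpoch q x k := by
      rw [Finset.sum_range_succ _ (n + 1), qbinom_self_succ hq0 hq1]; ring
    rw [h1, h3, eval_ascPoly, Finset.sum_range_succ' _ (n + 1), Finset.sum_range_succ' _ (n + 1),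
      Finset.mul_sum, ← add_assoc, ← Finset.sum_add_distrib]
    congr 1
    · exact Finset.sum_congr rfl fun k _ => by rw [qbinom_succ_succ hq0 hq1]; ring
    · simp
  have h4 : x * ∑ k ∈ Finset.range (n + 1), q ^ k * qbinom q n k * α⁻¹ ^ k * qpoch q x k =
      (ascPoly q α n).eval x - (1 - x) * (ascPoly q α n).eval (q * x) := by
    rw [h1, eval_ascPoly, Finset.mul_sum, ← Finset.sum_sub_distrib]
    exact Finset.sum_congr rfl fun k _ => by rw [qpoch_succ]; ring
  rw [h2]
  linear_combination α * h4 + x * (1 - x) * (ascPoly q α n).eval (q * x) * mul_inv_cancel₀ hα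

/-- Every nonzero real polynomial acquires constant sign after multiplication by the product of
`X - a` over suitable distinct roots `a` (those of odd multiplicity). -/
lemma exists_roots_prod_constant_sign (P : ℝ[X]) (hP : P ≠ 0) :
    ∃ S : Finset ℝ, S ⊆ P.roots.toFinset ∧
      ((∀ x, 0 ≤ (P * ∏ a ∈ S, (X - C a)).eval x) ∨
        (∀ x, (P * ∏ a ∈ S, (X - C a)).eval x ≤ 0)) := by
  induction h : P.natDegree generalizing P with
  | zero =>
    refine ⟨∅, by simp, ?_⟩
    rw [eq_C_of_natDegree_eq_zero h]
    simpa using le_total _ _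
  | succ d ih =>
    by_cases hroot : ∃ a, P.IsRoot a
    · obtain ⟨a, ha⟩ := hroot
      obtain ⟨Q, rfl⟩ := dvd_iff_isRoot.2 ha
      have hQ : Q ≠ 0 := right_ne_zero_of_mul hP
      have hd : Q.natDegree = d := by
        rw [natDegree_mul (X_sub_C_ne_zero a) hQ, natDegree_X_sub_C] at h
        omega
      obtain ⟨S, hS, hsign⟩ := ih Q hQ hd
      have hS' : ∀ b ∈ S, b ∈ ((X - C a) * Q).roots.toFinset := fun b hb => by
        have := hS hb
        rw [Multiset.mem_toFinset, mem_roots hQ] at this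
        rw [Multiset.mem_toFinset, mem_roots hP]
        simp [this.eq_zero]
      by_cases haS : a ∈ S
      · refine ⟨S.erase a, fun b hb => hS' b (Finset.mem_of_mem_erase hb), ?_⟩
        have : (X - C a) * Q * ∏ b ∈ S.erase a, (X - C b) = Q * ∏ b ∈ S, (X - C b) := by
          rw [← Finset.mul_prod_erase S (fun b => X - C b) haS]
          ring
        rwa [this]
      · refine ⟨insert a S, fun b hb => ?_, ?_⟩
        · rcases Finset.mem_insert.1 hb with rfl | hb
          · rwa [Multiset.mem_toFinset, mem_roots hP]
          · exact hS' b hb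
        · have (x : ℝ) : ((X - C a) * Q * ∏ b ∈ insert a S, (X - C b)).eval x =
              (x - a) ^ 2 * (Q * ∏ b ∈ S, (X - C b)).eval x := by
            rw [Finset.prod_insert haS]
            simp only [eval_mul, eval_sub, eval_X, eval_C]
            ring
          simp only [this]
          exact hsign.imp (fun h x => mul_nonneg (sq_nonneg _) (h x))
            fun h x => mul_nonpos_of_nonneg_of_nonpos (sq_nonneg _) (h x)
    · refine ⟨∅, by simp, ?_⟩
      simp only [Finset.prod_empty, mul_one]
      by_contra! hc
      obtain ⟨⟨x, hx⟩, y, hy⟩ := hc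
      obtain ⟨z, hz⟩ := mem_range_of_exists_le_of_exists_ge P.continuous ⟨x, hx.le⟩ ⟨y, hy.le⟩
      exact hroot ⟨z, hz⟩

/-- A functional on real polynomials that is strictly positive on nonzero nonnegative ones. -/
def IsPosFunctional (L : ℝ[X] →ₗ[ℝ] ℝ) : Prop :=
  ∀ f : ℝ[X], f ≠ 0 → (∀ x, 0 ≤ f.eval x) → 0 < L f

lemma IsPosFunctional.le_card_roots {L : ℝ[X] →ₗ[ℝ] ℝ} (hL : IsPosFunctional L) {n : ℕ}
    {P : ℝ[X]} (hP : P ≠ 0) (horth : ∀ f : ℝ[X], f.natDegree < n → L (P * f) = 0) :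
    n ≤ P.roots.toFinset.card := by
  obtain ⟨S, hS, hsign⟩ := exists_roots_prod_constant_sign P hP
  refine le_trans ?_ (Finset.card_le_card hS)
  by_contra! hlt
  have h0 : L (P * ∏ a ∈ S, (X - C a)) = 0 := by
    apply horth
    rwa [natDegree_finsetProd_X_sub_C_eq_card]
  have hne : P * ∏ a ∈ S, (X - C a) ≠ 0 :=
    mul_ne_zero hP (Finset.prod_ne_zero_iff.2 fun a _ => X_sub_C_ne_zero a)
  rcases hsign with h | h
  · exact (hL _ hne h).ne' h0
  · have := hL _ (neg_ne_zero.2 hne) fun x => by rw [eval_neg]; exact neg_nonneg.2 (h x)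
    rw [map_neg, h0, neg_zero] at this
    exact this.false

/-- Gauss quadrature at the zeros of an orthogonal polynomial. -/
lemma IsPosFunctional.exists_quadrature {L : ℝ[X] →ₗ[ℝ] ℝ} (hL : IsPosFunctional L) {n : ℕ}
    {P : ℝ[X]} (hP : P ≠ 0) (hdeg : P.natDegree ≤ n)
    (horth : ∀ f : ℝ[X], f.natDegree < n → L (P * f) = 0)
    {x : Fin n → ℝ} (hx : Function.Injective x) (hroot : ∀ i, P.IsRoot (x i)) :
    ∃ w : Fin n → ℝ, (∀ i, 0 < w i) ∧
      ∀ F : ℝ[X], F.natDegree < 2 * n → L F = ∑ i, w i * F.eval (x i) := by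
  have hdvd {f : ℝ[X]} (hf : ∀ i, f.IsRoot (x i)) : ∏ i, (X - C (x i)) ∣ f :=
    Finset.prod_dvd_of_coprime
      (fun i _ j _ hij => pairwise_coprime_X_sub_C hx hij) fun i _ => dvd_iff_isRoot.2 (hf i)
  have hmonic : (∏ i, (X - C (x i))).Monic := monic_prod_X_sub_C x Finset.univ
  have hnat : (∏ i, (X - C (x i))).natDegree = n := by
    rw [natDegree_finsetProd_X_sub_C_eq_card]; simp
  have hvanish {f : ℝ[X]} (hf : ∀ i, f.IsRoot (x i)) (hfd : f.natDegree < 2 * n) : L f = 0 := by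
    by_cases hf0 : f = 0
    · rw [hf0, map_zero]
    obtain ⟨g, rfl⟩ := hdvd hf
    obtain ⟨c, rfl⟩ := hdvd hroot
    have hc0 : c ≠ 0 := right_ne_zero_of_mul hP
    have hg0 : g ≠ 0 := right_ne_zero_of_mul hf0
    rw [hmonic.natDegree_mul' hc0, hnat] at hdeg
    rw [hmonic.natDegree_mul' hg0, hnat] at hfd
    obtain ⟨a, rfl⟩ : ∃ a, c = C a := ⟨_, eq_C_of_natDegree_eq_zero (by omega)⟩
    have ha : a ≠ 0 := by simpa using hc0
    have h := horth (C a⁻¹ * g) ((natDegree_C_mul_le _ _).trans_lt (by omega))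
    rw [← h]
    congr 1
    have : C a * C a⁻¹ = (1 : ℝ[X]) := by rw [← C_mul, mul_inv_cancel₀ ha, C_1]
    linear_combination (-(∏ i, (X - C (x i))) * g) * this
  have hinj : Set.InjOn x (Finset.univ : Finset (Fin n)) := hx.injOn
  refine ⟨fun i => L (Lagrange.basis Finset.univ x i ^ 2), fun i => hL _ ?_ ?_, fun F hF => ?_⟩
  · exact pow_ne_zero 2 (Lagrange.basis_ne_zero hinj (Finset.mem_univ i))
  · intro y
    rw [eval_pow]
    exact sq_nonneg _
  · have h := @hvanish (F - ∑ i, F.eval (x i) • Lagrange.basis Finset.univ x i ^ 2) ?_ ?_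
    · rw [map_sub, map_sum, sub_eq_zero] at h
      rw [h]
      exact Finset.sum_congr rfl fun i _ => by rw [map_smul, smul_eq_mul, mul_comm]
    · intro j
      rw [IsRoot, eval_sub, eval_finsetSum, Finset.sum_eq_single j]
      · simp [Lagrange.eval_basis_self hinj (Finset.mem_univ j)]
      · intro i _ hij
        simp [Lagrange.eval_basis_of_ne hij (Finset.mem_univ j)]
      · simp
    · refine (natDegree_sub_le _ _).trans_lt (max_lt hF ?_)
      refine (natDegree_sum_le_of_forall_le (n := 2 * (n - 1)) _ _ fun i _ => ?_).trans_lt (by omega)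
      refine (natDegree_smul_le _ _).trans (natDegree_pow_le.trans ?_)
      have := Lagrange.degree_basis hinj (Finset.mem_univ i)
      rw [natDegree_eq_of_degree_eq_some this]
      simp

/-- The Markov monotonicity principle for the zeros of orthogonal polynomials. -/
lemma zeros_lt_of_functional_lt {L₁ L₂ : ℝ[X] →ₗ[ℝ] ℝ} (h₁ : IsPosFunctional L₁)
    (h₂ : IsPosFunctional L₂)
    (hlt : ∀ (t : ℝ) (p : ℝ[X]), p ≠ 0 →
      ∃ c : ℝ, 0 < c ∧ c * L₁ ((X - C t) * p ^ 2) < L₂ ((X - C t) * p ^ 2))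
    {n : ℕ} {P₁ P₂ : ℝ[X]} (hP₁ : P₁ ≠ 0) (hP₂ : P₂ ≠ 0)
    (hdeg₁ : P₁.natDegree ≤ n) (hdeg₂ : P₂.natDegree ≤ n)
    (horth₁ : ∀ f : ℝ[X], f.natDegree < n → L₁ (P₁ * f) = 0)
    (horth₂ : ∀ f : ℝ[X], f.natDegree < n → L₂ (P₂ * f) = 0)
    {x y : Fin n → ℝ} (hx : StrictMono x) (hy : StrictMono y)
    (hxroot : ∀ i, P₁.IsRoot (x i)) (hyroot : ∀ i, P₂.IsRoot (y i)) (j : Fin n) :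
    x j < y j := by
  by_contra! hle
  obtain ⟨w₁, hw₁, hquad₁⟩ := h₁.exists_quadrature hP₁ hdeg₁ horth₁ hx.injective hxroot
  obtain ⟨w₂, hw₂, hquad₂⟩ := h₂.exists_quadrature hP₂ hdeg₂ horth₂ hy.injective hyroot
  set p : ℝ[X] := (∏ i ∈ Finset.Ioi j, (X - C (y i))) * ∏ i ∈ Finset.Iio j, (X - C (x i)) with hp
  have hp0 : p ≠ 0 := mul_ne_zero
    (Finset.prod_ne_zero_iff.2 fun a _ => X_sub_C_ne_zero _)
    (Finset.prod_ne_zero_iff.2 fun a _ => X_sub_C_ne_zero _)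
  have hpd : p.natDegree ≤ n - 1 := by
    refine natDegree_mul_le.trans ?_
    rw [natDegree_finsetProd_X_sub_C_eq_card, natDegree_finsetProd_X_sub_C_eq_card,
      Fin.card_Ioi, Fin.card_Iio]
    omega
  have hFd : ((X - C (x j)) * p ^ 2).natDegree < 2 * n := by
    refine natDegree_mul_le.trans_lt ?_
    have : (p ^ 2).natDegree ≤ 2 * p.natDegree := natDegree_pow_le
    rw [natDegree_X_sub_C]
    have := j.pos
    omega
  obtain ⟨c, hc, hlt⟩ := hlt (x j) p hp0
  rw [hquad₁ _ hFd, hquad₂ _ hFd] at hlt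
  refine (hlt.trans_le ?_).not_ge (mul_nonneg hc.le ?_)
  · refine Finset.sum_nonpos fun i _ => mul_nonpos_of_nonneg_of_nonpos (hw₂ i).le ?_
    simp only [eval_mul, eval_sub, eval_X, eval_C, eval_pow]
    rcases le_or_gt i j with hij | hij
    · exact mul_nonpos_of_nonpos_of_nonneg
        (sub_nonpos.2 ((hy.monotone hij).trans hle)) (sq_nonneg _)
    · have : p.eval (y i) = 0 := by
        rw [hp, eval_mul, eval_prod, Finset.prod_eq_zero (Finset.mem_Ioi.2 hij) (by simp), zero_mul]
      simp [this]
  · refine Finset.sum_nonneg fun i _ => mul_nonneg (hw₁ i).le ?_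
    simp only [eval_mul, eval_sub, eval_X, eval_C, eval_pow]
    rcases le_or_gt j i with hij | hij
    · exact mul_nonneg (sub_nonneg.2 (hx.monotone hij)) (sq_nonneg _)
    · have : p.eval (x i) = 0 := by
        rw [hp, eval_mul, eval_prod _ _ (x i), eval_prod _ _ (x i),
          Finset.prod_eq_zero (Finset.mem_Iio.2 hij) (by simp), mul_zero]
      simp [this]

/-- The functional `f ↦ ∑ w_s f(x_s)` of a discrete measure with finite moments. -/
noncomputable def discreteFunctional (w x : ℕ → ℝ)
    (hsum : ∀ f : ℝ[X], Summable fun s => w s * f.eval (x s)) : ℝ[X] →ₗ[ℝ] ℝ where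
  toFun f := ∑' s, w s * f.eval (x s)
  map_add' f g := by
    rw [← (hsum f).tsum_add (hsum g)]
    exact tsum_congr fun s => by rw [eval_add]; ring
  map_smul' c f := by
    rw [RingHom.id_apply, smul_eq_mul, ← tsum_mul_left]
    exact tsum_congr fun s => by rw [eval_smul, smul_eq_mul]; ring

lemma exists_gt_eval_ne_zero {x : ℕ → ℝ} (hx : Function.Injective x) {p : ℝ[X]} (hp : p ≠ 0)
    (N : ℕ) : ∃ s, N < s ∧ p.eval (x s) ≠ 0 := by
  by_contra! h
  refine hp (eq_zero_of_infinite_isRoot p (Set.Infinite.mono ?_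
    ((Set.Ioi_infinite N).image hx.injOn)))
  rintro _ ⟨s, hs, rfl⟩
  exact h s hs

lemma isPosFunctional_discreteFunctional {w x : ℕ → ℝ} (hw : ∀ s, 0 < w s)
    (hx : Function.Injective x) (hsum : ∀ f : ℝ[X], Summable fun s => w s * f.eval (x s)) :
    IsPosFunctional (discreteFunctional w x hsum) := by
  intro f hf hnonneg
  obtain ⟨s, -, hs⟩ := exists_gt_eval_ne_zero hx hf 0
  exact (hsum f).tsum_pos (fun i => mul_nonneg (hw i).le (hnonneg _)) s
    (mul_pos (hw s) ((hnonneg _).lt_of_ne' hs))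

lemma discreteFunctional_lt {w₁ w₂ x : ℕ → ℝ} (hw₁ : ∀ s, 0 < w₁ s) (hw₂ : ∀ s, 0 < w₂ s)
    (hratio : StrictMono fun s => w₂ s / w₁ s) (hx : StrictMono x)
    (hxtop : Filter.Tendsto x Filter.atTop Filter.atTop)
    (hsum₁ : ∀ f : ℝ[X], Summable fun s => w₁ s * f.eval (x s))
    (hsum₂ : ∀ f : ℝ[X], Summable fun s => w₂ s * f.eval (x s))
    (t : ℝ) (p : ℝ[X]) (hp : p ≠ 0) :
    ∃ c : ℝ, 0 < c ∧ c * discreteFunctional w₁ x hsum₁ ((X - C t) * p ^ 2) <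
      discreteFunctional w₂ x hsum₂ ((X - C t) * p ^ 2) := by
  classical
  have hex : ∃ s, t < x s := (hxtop.eventually_gt_atTop t).exists
  set N := Nat.find hex with hN
  have hNt : t < x N := Nat.find_spec hex
  refine ⟨w₂ N / w₁ N, div_pos (hw₂ N) (hw₁ N), ?_⟩
  rw [← sub_pos]
  have heq : discreteFunctional w₂ x hsum₂ ((X - C t) * p ^ 2) -
      w₂ N / w₁ N * discreteFunctional w₁ x hsum₁ ((X - C t) * p ^ 2) =
      ∑' s, (w₂ s - w₂ N / w₁ N * w₁ s) * ((x s - t) * p.eval (x s) ^ 2) := by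
    simp only [discreteFunctional, LinearMap.coe_mk, AddHom.coe_mk]
    rw [← tsum_mul_left, ← (hsum₂ _).tsum_sub ((hsum₁ _).mul_left _)]
    refine tsum_congr fun s => ?_
    simp only [eval_mul, eval_sub, eval_X, eval_C, eval_pow]
    ring
  have hS : Summable fun s =>
      (w₂ s - w₂ N / w₁ N * w₁ s) * ((x s - t) * p.eval (x s) ^ 2) := by
    refine ((hsum₂ ((X - C t) * p ^ 2)).sub
      ((hsum₁ ((X - C t) * p ^ 2)).mul_left (w₂ N / w₁ N))).congr fun s => ?_
    simp only [eval_mul, eval_sub, eval_X, eval_C, eval_pow]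
    ring
  have hfac (s : ℕ) : (w₂ s - w₂ N / w₁ N * w₁ s) * ((x s - t) * p.eval (x s) ^ 2) =
      w₁ s * (((w₂ s / w₁ s - w₂ N / w₁ N) * (x s - t)) * p.eval (x s) ^ 2) := by
    have := (hw₁ s).ne'
    have := (hw₁ N).ne'
    field_simp
  rw [heq]
  obtain ⟨s, hNs, hs⟩ := exists_gt_eval_ne_zero hx.injective hp N
  refine hS.tsum_pos (fun i => ?_) s ?_
  · rw [hfac]
    refine mul_nonneg (hw₁ i).le (mul_nonneg ?_ (sq_nonneg _))
    rcases lt_or_ge i N with hi | hi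
    · exact mul_nonneg_of_nonpos_of_nonpos (sub_nonpos.2 (hratio hi).le)
        (sub_nonpos.2 (not_lt.1 (Nat.find_min hex hi)))
    · exact mul_nonneg (sub_nonneg.2 (hratio.monotone hi))
        (sub_nonneg.2 (hNt.le.trans (hx.monotone hi)))
  · rw [hfac]
    exact mul_pos (hw₁ s) (mul_pos (mul_pos (sub_pos.2 (hratio hNs))
      (sub_pos.2 (hNt.trans (hx hNs)))) (by positivity))

/-- The orthogonality weight `α^s q^{s²} / ((q;q)_s (αq;q)_s)` at the point `q^{-s}`. -/
noncomputable def ascWeight (q α : ℝ) (s : ℕ) : ℝ :=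
  ∏ i ∈ Finset.range s, α * q ^ (2 * i + 1) / ((1 - q ^ (i + 1)) * (1 - α * q ^ (i + 1)))

lemma one_sub_mul_pow_succ_pos {q α : ℝ} (hq0 : 0 < q) (hq1 : q < 1) (hα : 0 < α)
    (hα' : α < q⁻¹) (k : ℕ) : 0 < 1 - α * q ^ (k + 1) := by
  have h1 : α * q < 1 := by rwa [← lt_div_iff₀ hq0, one_div]
  have h2 : q ^ k ≤ 1 := pow_le_one₀ hq0.le hq1.le
  have h3 : α * q * q ^ k ≤ α * q * 1 := by gcongr
  rw [pow_succ']
  linarith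

lemma ascWeight_succ (q α : ℝ) (s : ℕ) :
    ascWeight q α (s + 1) = ascWeight q α s *
      (α * q ^ (2 * s + 1) / ((1 - q ^ (s + 1)) * (1 - α * q ^ (s + 1)))) :=
  Finset.prod_range_succ _ _

lemma ascWeight_pos {q α : ℝ} (hq0 : 0 < q) (hq1 : q < 1) (hα : 0 < α) (hα' : α < q⁻¹) (s : ℕ) :
    0 < ascWeight q α s := by
  refine Finset.prod_pos fun i _ => ?_
  have := one_sub_pow_succ_pos hq0 hq1 i
  have := one_sub_mul_pow_succ_pos hq0 hq1 hα hα' i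
  positivity

lemma strictMono_ascWeight_div {q α β : ℝ} (hq0 : 0 < q) (hq1 : q < 1) (hα : 0 < α)
    (hαβ : α < β) (hβ : β < q⁻¹) :
    StrictMono fun s => ascWeight q β s / ascWeight q α s := by
  refine strictMono_nat_of_lt_succ fun s => ?_
  have h0 := one_sub_pow_succ_pos hq0 hq1 s
  have h1 := one_sub_mul_pow_succ_pos hq0 hq1 hα (hαβ.trans hβ) s
  have h2 := one_sub_mul_pow_succ_pos hq0 hq1 (hα.trans hαβ) hβ s
  have h3 := ascWeight_pos hq0 hq1 hα (hαβ.trans hβ) s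
  have h4 := ascWeight_pos hq0 hq1 (hα.trans hαβ) hβ s
  have h5 : ascWeight q β (s + 1) / ascWeight q α (s + 1) =
      ascWeight q β s / ascWeight q α s *
        (β * (1 - α * q ^ (s + 1)) / (α * (1 - β * q ^ (s + 1)))) := by
    rw [ascWeight_succ, ascWeight_succ]
    field_simp
  rw [h5]
  refine lt_mul_of_one_lt_right (div_pos h4 h3) ?_
  rw [one_lt_div (mul_pos hα h2)]
  linarith

lemma summable_ascWeight_mul_pow {q α : ℝ} (hq0 : 0 < q) (hq1 : q < 1) (hα : 0 < α)
    (hα' : α < q⁻¹) (m : ℕ) : Summable fun s => ascWeight q α s * (q ^ s)⁻¹ ^ m := by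
  have hpos (s : ℕ) : 0 < ascWeight q α s * (q ^ s)⁻¹ ^ m :=
    mul_pos (ascWeight_pos hq0 hq1 hα hα' s) (by positivity)
  refine summable_of_ratio_test_tendsto_lt_one zero_lt_one
    (Filter.Eventually.of_forall fun s => (hpos s).ne') ?_
  have hratio (s : ℕ) : ‖ascWeight q α (s + 1) * (q ^ (s + 1))⁻¹ ^ m‖ /
      ‖ascWeight q α s * (q ^ s)⁻¹ ^ m‖ =
      α * (q ^ s * q ^ s * q) / ((1 - q ^ s * q) * (1 - α * (q ^ s * q))) * q⁻¹ ^ m := by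
    rw [Real.norm_of_nonneg (hpos _).le, Real.norm_of_nonneg (hpos _).le, ascWeight_succ]
    have h0 := (one_sub_pow_succ_pos hq0 hq1 s).ne'
    have h1 := (one_sub_mul_pow_succ_pos hq0 hq1 hα hα' s).ne'
    have h2 := (ascWeight_pos hq0 hq1 hα hα' s).ne'
    have h3 : q ^ (2 * s + 1) = q ^ s * q ^ s * q := by ring
    rw [h3, pow_succ q s, mul_inv, mul_pow]
    have h4 : ((q ^ s)⁻¹ ^ m) ≠ 0 := by positivity
    rw [div_eq_iff (mul_ne_zero h2 h4)]
    ring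
  simp only [hratio]
  have hq : Filter.Tendsto (fun s : ℕ => q ^ s) Filter.atTop (nhds 0) :=
    tendsto_pow_atTop_nhds_zero_of_lt_one hq0.le hq1
  have hlim : Filter.Tendsto (fun y : ℝ =>
      α * (y * y * q) / ((1 - y * q) * (1 - α * (y * q))) * q⁻¹ ^ m) (nhds 0) (nhds 0) := by
    have : ContinuousAt (fun y : ℝ =>
        α * (y * y * q) / ((1 - y * q) * (1 - α * (y * q))) * q⁻¹ ^ m) 0 := by
      refine ContinuousAt.mul (ContinuousAt.div ?_ ?_ (by simp)) continuousAt_const <;> fun_prop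
    simpa [ContinuousAt] using this
  exact hlim.comp hq

lemma summable_ascWeight_mul_eval {q α : ℝ} (hq0 : 0 < q) (hq1 : q < 1) (hα : 0 < α)
    (hα' : α < q⁻¹) (f : ℝ[X]) : Summable fun s => ascWeight q α s * f.eval (q ^ s)⁻¹ := by
  have := summable_sum (s := Finset.range (f.natDegree + 1)) fun m _ =>
    (summable_ascWeight_mul_pow hq0 hq1 hα hα' m).mul_left (f.coeff m)
  refine this.congr fun s => ?_
  rw [eval_eq_sum_range, Finset.mul_sum]
  exact Finset.sum_congr rfl fun m _ => by ring

lemma summable_ascWeight_mul_eval_mul_pow {q α : ℝ} (hq0 : 0 < q) (hq1 : q < 1) (hα : 0 < α)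
    (hα' : α < q⁻¹) (f : ℝ[X]) :
    Summable fun s => ascWeight q α s * f.eval (q ^ s)⁻¹ * q ^ s := by
  refine Summable.of_norm_bounded (summable_ascWeight_mul_eval hq0 hq1 hα hα' f).norm fun s => ?_
  rw [norm_mul, Real.norm_of_nonneg (pow_pos hq0 s).le]
  exact mul_le_of_le_one_right (norm_nonneg _) (pow_le_one₀ hq0.le hq1.le)

/-- The functional of orthogonality of the second family Al-Salam–Carlitz polynomials. -/
noncomputable def ascFunctional {q α : ℝ} (hq0 : 0 < q) (hq1 : q < 1) (hα : 0 < α)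
    (hlt : α < q⁻¹) : ℝ[X] →ₗ[ℝ] ℝ :=
  discreteFunctional (ascWeight q α) (fun s => (q ^ s)⁻¹)
    (summable_ascWeight_mul_eval hq0 hq1 hα hlt)

/-- The `q⁻¹`-difference operator `f ↦ (f(x) - f(x/q)) / x`. -/
noncomputable def qDiff (q : ℝ) (f : ℝ[X]) : ℝ[X] := (f - f.comp (C q⁻¹ * X)).divX

lemma qDiff_eval_mul (q : ℝ) (f : ℝ[X]) (x : ℝ) :
    (qDiff q f).eval x * x = f.eval x - f.eval (q⁻¹ * x) := by
  have h := congrArg (eval x) (divX_mul_X_add (f - f.comp (C q⁻¹ * X)))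
  have h0 : (f - f.comp (C q⁻¹ * X)).coeff 0 = 0 := by
    simp [coeff_zero_eq_eval_zero, eval_comp]
  rw [h0] at h
  simpa [qDiff, eval_comp] using h

lemma natDegree_qDiff_le (q : ℝ) (f : ℝ[X]) : (qDiff q f).natDegree ≤ f.natDegree - 1 := by
  rw [qDiff, natDegree_divX_eq_natDegree_tsub_one]
  refine Nat.sub_le_sub_right ((natDegree_sub_le _ _).trans (max_le le_rfl ?_)) 1
  refine natDegree_comp_le.trans (mul_le_of_le_one_right (Nat.zero_le _) ?_)
  compute_degree

lemma qDiff_eq_zero (q : ℝ) {f : ℝ[X]} (hf : f.natDegree = 0) : qDiff q f = 0 := by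
  rw [eq_C_of_natDegree_eq_zero hf, qDiff, C_comp, sub_self, divX_zero]

lemma ascFunctional_ascPoly_succ_mul {q α : ℝ} (hq0 : 0 < q) (hq1 : q < 1) (hα : 0 < α)
    (hα' : α < q⁻¹) (n : ℕ) (f : ℝ[X]) :
    ascFunctional hq0 hq1 hα hα' (ascPoly q α (n + 1) * f) =
      ascFunctional hq0 hq1 hα hα' (ascPoly q α n * qDiff q f) := by
  set U := ascPoly q α n with hU
  set A : ℕ → ℝ := fun s => ascWeight q α s * (U * f).eval (q ^ s)⁻¹ * q ^ s with hA
  set B : ℕ → ℝ := fun s => ascWeight q α s *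
    (C α⁻¹ * (X - 1) * (X - C α) * U.comp (C q * X) * f).eval (q ^ s)⁻¹ * q ^ s with hB
  have hAsum : Summable A := summable_ascWeight_mul_eval_mul_pow hq0 hq1 hα hα' _
  have hBsum : Summable B := summable_ascWeight_mul_eval_mul_pow hq0 hq1 hα hα' _
  have hleft (s : ℕ) : ascWeight q α s * (ascPoly q α (n + 1) * f).eval (q ^ s)⁻¹ =
      A s - B s := by
    have h := ascPoly_raising hq0 hq1 hα.ne' n (q ^ s)⁻¹
    have hqs : q ^ s ≠ 0 := (pow_pos hq0 s).ne'
    simp only [hA, hB, eval_mul, eval_sub, eval_X, eval_C, eval_comp, eval_one]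
    have h' : (ascPoly q α (n + 1)).eval (q ^ s)⁻¹ = α⁻¹ * q ^ s *
        (α * (q ^ s)⁻¹ * (ascPoly q α (n + 1)).eval (q ^ s)⁻¹) := by
      field_simp
    rw [h', h, ← hU]
    field_simp
  have hright (s : ℕ) : ascWeight q α s * (U * qDiff q f).eval (q ^ s)⁻¹ = A s - B (s + 1) := by
    have hqs : q ^ s ≠ 0 := (pow_pos hq0 s).ne'
    have h := qDiff_eval_mul q f (q ^ s)⁻¹
    have h' : (qDiff q f).eval (q ^ s)⁻¹ =
        (f.eval (q ^ s)⁻¹ - f.eval (q⁻¹ * (q ^ s)⁻¹)) * q ^ s := by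
      rw [← h]; field_simp
    have h0 := (one_sub_pow_succ_pos hq0 hq1 s).ne'
    have h1 := (one_sub_mul_pow_succ_pos hq0 hq1 hα hα' s).ne'
    have hx : (q ^ (s + 1))⁻¹ = q⁻¹ * (q ^ s)⁻¹ := by rw [pow_succ', mul_inv]
    have hx' : q * (q⁻¹ * (q ^ s)⁻¹) = (q ^ s)⁻¹ := by rw [mul_inv_cancel_left₀ hq0.ne']
    have hw : ascWeight q α (s + 1) * (α⁻¹ * (q⁻¹ * (q ^ s)⁻¹ - 1) * (q⁻¹ * (q ^ s)⁻¹ - α)) *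
        q ^ (s + 1) = ascWeight q α s * q ^ s := by
      have e1 : q⁻¹ * (q ^ s)⁻¹ - 1 = (1 - q ^ (s + 1)) * (q ^ (s + 1))⁻¹ := by
        rw [← hx, sub_mul, mul_inv_cancel₀ (pow_pos hq0 _).ne', one_mul]
      have e2 : q⁻¹ * (q ^ s)⁻¹ - α = (1 - α * q ^ (s + 1)) * (q ^ (s + 1))⁻¹ := by
        rw [← hx, sub_mul, mul_assoc, mul_inv_cancel₀ (pow_pos hq0 _).ne', one_mul, mul_one]
      have e3 : q ^ (2 * s + 1) = q ^ (s + 1) * q ^ s := by ring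
      rw [e1, e2, ascWeight_succ, e3]
      have h2 : q ^ (s + 1) ≠ 0 := (pow_pos hq0 _).ne'
      generalize q ^ (s + 1) = y at *
      field_simp
    simp only [hA, hB, eval_mul, eval_sub, eval_X, eval_C, eval_comp, eval_one, hx, hx', h']
    linear_combination U.eval (q ^ s)⁻¹ * f.eval (q⁻¹ * (q ^ s)⁻¹) * hw
  have hB0 : B 0 = 0 := by simp [hB]
  have hBshift : ∑' s, B s = ∑' s, B (s + 1) := by rw [hBsum.tsum_eq_zero_add, hB0, zero_add]
  simp only [ascFunctional, discreteFunctional, LinearMap.coe_mk, AddHom.coe_mk]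
  rw [tsum_congr hleft, tsum_congr hright, hAsum.tsum_sub hBsum,
    hAsum.tsum_sub ((summable_nat_add_iff 1).2 hBsum), hBshift]

lemma ascFunctional_ascPoly_mul {q α : ℝ} (hq0 : 0 < q) (hq1 : q < 1) (hα : 0 < α)
    (hα' : α < q⁻¹) (n : ℕ) (f : ℝ[X]) (hf : f.natDegree < n) :
    ascFunctional hq0 hq1 hα hα' (ascPoly q α n * f) = 0 := by
  induction n generalizing f with
  | zero => omega
  | succ n ih =>
    rw [ascFunctional_ascPoly_succ_mul]
    rcases Nat.eq_zero_or_pos f.natDegree with h | h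
    · rw [qDiff_eq_zero q h, mul_zero, map_zero]
    · exact ih _ ((natDegree_qDiff_le q f).trans_lt (by omega))

lemma strictMono_inv_pow {q : ℝ} (hq0 : 0 < q) (hq1 : q < 1) :
    StrictMono fun s : ℕ => (q ^ s)⁻¹ := fun _ _ h =>
  inv_strictAnti₀ (pow_pos hq0 _) (pow_lt_pow_right_of_lt_one₀ hq0 hq1 h)

lemma isPosFunctional_ascFunctional {q α : ℝ} (hq0 : 0 < q) (hq1 : q < 1) (hα : 0 < α)
    (hα' : α < q⁻¹) : IsPosFunctional (ascFunctional hq0 hq1 hα hα') :=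
  isPosFunctional_discreteFunctional (ascWeight_pos hq0 hq1 hα hα')
    (strictMono_inv_pow hq0 hq1).injective _

lemma card_roots_ascPoly {q α : ℝ} (hq0 : 0 < q) (hq1 : q < 1) (hα : 0 < α)
    (hα' : α < q⁻¹) (n : ℕ) : (ascPoly q α n).roots.toFinset.card = n :=
  le_antisymm
    (((Multiset.toFinset_card_le _).trans (card_roots' _)).trans (natDegree_ascPoly_le q α n))
    ((isPosFunctional_ascFunctional hq0 hq1 hα hα').le_card_roots (ascPoly_ne_zero q α n)
      (ascFunctional_ascPoly_mul hq0 hq1 hα hα' n))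

end

/-- zeros of the second family Al-Salam–Carlitz polynomials:
monotonicity in `α`. -/
theorem stmt_9 (q : ℝ) (hq0 : 0 < q) (hq1 : q < 1) (n : ℕ) (hn : 1 ≤ n) :
    ∃ x : ℝ → Fin n → ℝ,
      (∀ α : ℝ, 0 < α → α < q⁻¹ →
        StrictMono (x α) ∧
        (∀ j, alSalamCarlitzV q n α (x α j) = 0) ∧
        (∀ y : ℝ, alSalamCarlitzV q n α y = 0 → ∃ j, y = x α j)) ∧
      (∀ j, StrictMonoOn (fun α => x α j) (Set.Ioo 0 q⁻¹)) := by
  have hcard (α : ℝ) (h : 0 < α ∧ α < q⁻¹) := card_roots_ascPoly hq0 hq1 h.1 h.2 n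
  classical
  let x : ℝ → Fin n → ℝ := fun α =>
    if h : 0 < α ∧ α < q⁻¹ then (ascPoly q α n).roots.toFinset.orderEmbOfFin (hcard α h) else 0
  have hx (α : ℝ) (h : 0 < α ∧ α < q⁻¹) :
      x α = (ascPoly q α n).roots.toFinset.orderEmbOfFin (hcard α h) := dif_pos h
  have hmono (α : ℝ) (h : 0 < α ∧ α < q⁻¹) : StrictMono (x α) := by
    rw [hx α h]
    exact OrderEmbedding.strictMono _
  have hroot (α : ℝ) (h : 0 < α ∧ α < q⁻¹) (j : Fin n) : (ascPoly q α n).IsRoot (x α j) := by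
    rw [hx α h]
    have := Finset.orderEmbOfFin_mem _ (hcard α h) j
    rwa [Multiset.mem_toFinset, Polynomial.mem_roots (ascPoly_ne_zero q α n)] at this
  refine ⟨x, fun α h0 h1 => ⟨hmono α ⟨h0, h1⟩, fun j => ?_, fun y hy => ?_⟩,
    fun j α hα β hβ hαβ => ?_⟩
  · exact (alSalamCarlitzV_eq_zero_iff hq0.ne' h0.ne' n _).2 (hroot α ⟨h0, h1⟩ j)
  · rw [alSalamCarlitzV_eq_zero_iff hq0.ne' h0.ne', ← Polynomial.mem_roots (ascPoly_ne_zero q α n),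
      ← Multiset.mem_toFinset, ← Finset.mem_coe,
      ← Finset.range_orderEmbOfFin _ (hcard α ⟨h0, h1⟩)] at hy
    obtain ⟨j, hj⟩ := hy
    exact ⟨j, by rw [hx α ⟨h0, h1⟩, hj]⟩
  · refine zeros_lt_of_functional_lt
      (isPosFunctional_ascFunctional hq0 hq1 hα.1 hα.2)
      (isPosFunctional_ascFunctional hq0 hq1 hβ.1 hβ.2)
      (discreteFunctional_lt (ascWeight_pos hq0 hq1 hα.1 hα.2) (ascWeight_pos hq0 hq1 hβ.1 hβ.2)
        (strictMono_ascWeight_div hq0 hq1 hα.1 hαβ hβ.2) (strictMono_inv_pow hq0 hq1)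
        ?_ _ _)
      (ascPoly_ne_zero q α n) (ascPoly_ne_zero q β n)
      (natDegree_ascPoly_le q α n) (natDegree_ascPoly_le q β n)
      (ascFunctional_ascPoly_mul hq0 hq1 hα.1 hα.2 n)
      (ascFunctional_ascPoly_mul hq0 hq1 hβ.1 hβ.2 n)
      (hmono α hα) (hmono β hβ) (hroot α hα) (hroot β hβ) j
    simp only [← inv_pow]
    exact tendsto_pow_atTop_atTop_of_one_lt ((one_lt_inv₀ hq0).2 hq1)
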